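/- Let k ≥ 1 be an integer and for each i = 1,…,k let m_i ≥ 1 be an integer. For each i and each j = 1,…,m_i let b_{ij} be an integer with b_{ij} ≥ 2 and let a_{ij} be an integer with a_{ij} ≥ 1. Then there exist positive integers t and x_{ij} (for all i = 1,…,k and j = 1,…,m_i), all ≥ 1, satisfying: for every i and every j = 1,…,m_i, x_{i,j−1} − b_{ij}·x_{ij} + x_{i,j+1} + a_{ij}·t = 0, where by convention x_{i,0} = x_{i,m_i+1} = 0. -/

import Mathlib

/-- The sequence with `u 0 = 0`, `u 1 = c` and
`u (j + 2) = b (j + 1) * u (j + 1) - u j - d (j + 1)`. -/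
def chainSeq (b d : ℕ → ℤ) (c : ℤ) : ℕ → ℤ
  | 0 => 0
  | 1 => c
  | j + 2 => b (j + 1) * chainSeq b d c (j + 1) - chainSeq b d c j - d (j + 1)

theorem chainSeq_add_two (b d : ℕ → ℤ) (c : ℤ) (j : ℕ) :
    chainSeq b d c (j + 2) =
      b (j + 1) * chainSeq b d c (j + 1) - chainSeq b d c j - d (j + 1) := by
  rw [chainSeq]

theorem chainSeq_zero_one_nonneg_and_lt {b : ℕ → ℤ} (hb : ∀ j, 2 ≤ b j) (j : ℕ) :
    0 ≤ chainSeq b 0 1 j ∧ chainSeq b 0 1 j < chainSeq b 0 1 (j + 1) := by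
  induction j with
  | zero => simp [chainSeq]
  | succ j ih =>
    obtain ⟨h0, h1⟩ := ih
    refine ⟨by linarith, ?_⟩
    rw [chainSeq_add_two]
    have := hb (j + 1)
    simp only [Pi.zero_apply]
    nlinarith

theorem chainSeq_zero_one_pos {b : ℕ → ℤ} (hb : ∀ j, 2 ≤ b j) (j : ℕ) :
    0 < chainSeq b 0 1 (j + 1) := by
  obtain ⟨h0, h1⟩ := chainSeq_zero_one_nonneg_and_lt hb j
  linarith

/-- The Casoratian of the homogeneous and the particular solution is positive. -/
theorem chainSeq_casoratian_pos {b a : ℕ → ℤ} (hb : ∀ j, 2 ≤ b j) (ha : ∀ j, 1 ≤ a j) (j : ℕ) :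
    0 < chainSeq b a 0 (j + 1) * chainSeq b 0 1 (j + 2) -
      chainSeq b a 0 (j + 2) * chainSeq b 0 1 (j + 1) := by
  induction j with
  | zero =>
    have := ha 1
    simp [chainSeq]
    linarith
  | succ j ih =>
    have hp := chainSeq_zero_one_pos hb (j + 1)
    have h := mul_pos (lt_of_lt_of_le one_pos (ha (j + 2))) hp
    rw [chainSeq_add_two b a 0 (j + 1), chainSeq_add_two b 0 1 (j + 1)]
    simp only [Pi.zero_apply, add_assoc, Nat.reduceAdd] at *
    linarith

theorem chainSeq_cross_pos {b a : ℕ → ℤ} (hb : ∀ j, 2 ≤ b j) (ha : ∀ j, 1 ≤ a j) (j n : ℕ) :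
    0 < chainSeq b a 0 (j + 1) * chainSeq b 0 1 (j + n + 2) -
      chainSeq b a 0 (j + n + 2) * chainSeq b 0 1 (j + 1) := by
  induction n with
  | zero => exact chainSeq_casoratian_pos hb ha j
  | succ n ih =>
    have hW := chainSeq_casoratian_pos hb ha (j + n + 1)
    have hj := chainSeq_zero_one_pos hb j
    have hn := chainSeq_zero_one_pos hb (j + n + 1)
    have hn' := chainSeq_zero_one_pos hb (j + n + 2)
    have h₁ := mul_pos ih hn'
    have h₂ := mul_pos hj hW
    refine pos_of_mul_pos_left (b := chainSeq b 0 1 (j + n + 2)) ?_ hn.le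
    simp only [← add_assoc, add_right_comm _ 1] at *
    ring_nf at *
    linarith

/-- A single chain of length `m` admits a positive solution. -/
theorem exists_pos_chain_solution (m : ℕ) (b a : ℕ → ℤ)
    (hb : ∀ j, 1 ≤ j → j ≤ m → 2 ≤ b j) (ha : ∀ j, 1 ≤ j → j ≤ m → 1 ≤ a j) :
    ∃ (t : ℤ) (x : ℕ → ℤ), 0 < t ∧ (∀ j, 1 ≤ j → j ≤ m → 0 < x j) ∧ x 0 = 0 ∧ x (m + 1) = 0 ∧
      ∀ j, 1 ≤ j → j ≤ m → x (j - 1) - b j * x j + x (j + 1) + a j * t = 0 := by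
  set B : ℕ → ℤ := fun j => max 2 (b j) with hB
  set A : ℕ → ℤ := fun j => max 1 (a j) with hA
  have hB2 : ∀ j, 2 ≤ B j := fun j => le_max_left _ _
  have hA1 : ∀ j, 1 ≤ A j := fun j => le_max_left _ _
  refine ⟨chainSeq B 0 1 (m + 1), fun j => chainSeq B A 0 j * chainSeq B 0 1 (m + 1) -
    chainSeq B A 0 (m + 1) * chainSeq B 0 1 j, chainSeq_zero_one_pos hB2 m, ?_, ?_, ?_, ?_⟩
  · intro j hj hjm
    obtain ⟨j, rfl⟩ := Nat.exists_eq_add_of_le' hj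
    obtain ⟨n, rfl⟩ := Nat.exists_eq_add_of_le hjm
    have h := chainSeq_cross_pos hB2 hA1 j n
    rwa [show j + n + 2 = j + 1 + n + 1 by ring] at h
  · simp [chainSeq]
  · ring
  · intro j hj hjm
    have hbj : B j = b j := max_eq_right (hb j hj hjm)
    have haj : A j = a j := max_eq_right (ha j hj hjm)
    obtain ⟨j, rfl⟩ := Nat.exists_eq_add_of_le' hj
    simp only [Nat.add_sub_cancel, chainSeq_add_two _ _ _ j, hbj, haj, Pi.zero_apply]
    ring


/-- For `k` disjoint chains, there exist positive integers `t` and `x_{ij}`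
(`1 ≤ i ≤ k`, `1 ≤ j ≤ m_i`) satisfying, for every `i` and `j`,
`x_{i,j-1} - b_{ij} x_{ij} + x_{i,j+1} + a_{ij} t = 0`, with the convention
`x_{i,0} = x_{i,m_i+1} = 0`. -/
theorem stmt_7 (k : ℕ) (hk : 1 ≤ k) (m : ℕ → ℕ)
    (hm : ∀ i, 1 ≤ i → i ≤ k → 1 ≤ m i)
    (b a : ℕ → ℕ → ℤ)
    (hb : ∀ i j, 1 ≤ i → i ≤ k → 1 ≤ j → j ≤ m i → 2 ≤ b i j)
    (ha : ∀ i j, 1 ≤ i → i ≤ k → 1 ≤ j → j ≤ m i → 1 ≤ a i j) :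
    ∃ (t : ℤ) (x : ℕ → ℕ → ℤ),
      1 ≤ t ∧
      (∀ i j, 1 ≤ i → i ≤ k → 1 ≤ j → j ≤ m i → 1 ≤ x i j) ∧
      (∀ i, 1 ≤ i → i ≤ k → x i 0 = 0 ∧ x i (m i + 1) = 0) ∧
      (∀ i j, 1 ≤ i → i ≤ k → 1 ≤ j → j ≤ m i →
        x i (j - 1) - b i j * x i j + x i (j + 1) + a i j * t = 0) := by
  have key : ∀ i, ∃ (t : ℤ) (x : ℕ → ℤ), 1 ≤ i → i ≤ k → 0 < t ∧
      (∀ j, 1 ≤ j → j ≤ m i → 0 < x j) ∧ x 0 = 0 ∧ x (m i + 1) = 0 ∧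
      ∀ j, 1 ≤ j → j ≤ m i → x (j - 1) - b i j * x j + x (j + 1) + a i j * t = 0 := by
    intro i
    by_cases h : 1 ≤ i ∧ i ≤ k
    · obtain ⟨t, x, H⟩ := exists_pos_chain_solution (m i) (b i) (a i)
        (fun j => hb i j h.1 h.2) (fun j => ha i j h.1 h.2)
      exact ⟨t, x, fun _ _ => H⟩
    · exact ⟨0, 0, fun h₁ h₂ => absurd ⟨h₁, h₂⟩ h⟩
  choose t x H using key
  set T : ℤ := ∏ i ∈ Finset.Icc 1 k, t i with hT
  have hTpos : 0 < T := Finset.prod_pos fun i hi =>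
    (H i (Finset.mem_Icc.1 hi).1 (Finset.mem_Icc.1 hi).2).1
  have hdiv : ∀ i, 1 ≤ i → i ≤ k → t i * (T / t i) = T := fun i h₁ h₂ =>
    Int.mul_ediv_cancel' (Finset.dvd_prod_of_mem t (Finset.mem_Icc.2 ⟨h₁, h₂⟩))
  refine ⟨T, fun i j => T / t i * x i j, hTpos, ?_, ?_, ?_⟩
  · intro i j h₁ h₂ hj hjm
    obtain ⟨ht, hx, -⟩ := H i h₁ h₂
    have hc : 0 < T / t i := pos_of_mul_pos_right (by rwa [hdiv i h₁ h₂]) ht.le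
    exact mul_pos hc (hx j hj hjm)
  · intro i h₁ h₂
    obtain ⟨-, -, h0, hm', -⟩ := H i h₁ h₂
    simp [h0, hm']
  · intro i j h₁ h₂ hj hjm
    have h := (H i h₁ h₂).2.2.2.2 j hj hjm
    linear_combination (T / t i) * h - a i j * hdiv i h₁ h₂
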